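/- Suppose the two-dimensional periodic grid functions uⁿ, uⁿ¹, uⁿ² satisfy the ADI diffusion half-step equations: (i) H₁ₓ A_y uⁿ¹ = (A_x A_y + (ντ/4)·A_y δ_x² + (ντ/2)·A_x δ_y²) uⁿ and (ii) H₁ᵧ uⁿ² = A_y uⁿ¹ − (ντ/4)·δ_y² uⁿ. Then Σ_{i,j} hx·hy·uⁿ²(i,j) = Σ_{i,j} hx·hy·uⁿ(i,j) (the two-dimensional ADI diffusion half-step conserves the discrete mass). -/

import Mathlib

noncomputable def Ax {Nx Ny : ℕ} (u : ZMod Nx × ZMod Ny → ℝ) : ZMod Nx × ZMod Ny → ℝ :=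
  fun p => (u (p.1 - 1, p.2) + 10 * u p + u (p.1 + 1, p.2)) / 12

noncomputable def Ay {Nx Ny : ℕ} (u : ZMod Nx × ZMod Ny → ℝ) : ZMod Nx × ZMod Ny → ℝ :=
  fun p => (u (p.1, p.2 - 1) + 10 * u p + u (p.1, p.2 + 1)) / 12

noncomputable def Bx {Nx Ny : ℕ} (u : ZMod Nx × ZMod Ny → ℝ) : ZMod Nx × ZMod Ny → ℝ :=
  fun p => (u (p.1 - 1, p.2) + 4 * u p + u (p.1 + 1, p.2)) / 6

noncomputable def By {Nx Ny : ℕ} (u : ZMod Nx × ZMod Ny → ℝ) : ZMod Nx × ZMod Ny → ℝ :=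
  fun p => (u (p.1, p.2 - 1) + 4 * u p + u (p.1, p.2 + 1)) / 6

noncomputable def d2x {Nx Ny : ℕ} (hx : ℝ) (u : ZMod Nx × ZMod Ny → ℝ) : ZMod Nx × ZMod Ny → ℝ :=
  fun p => (u (p.1 + 1, p.2) - 2 * u p + u (p.1 - 1, p.2)) / hx ^ 2

noncomputable def d2y {Nx Ny : ℕ} (hy : ℝ) (u : ZMod Nx × ZMod Ny → ℝ) : ZMod Nx × ZMod Ny → ℝ :=
  fun p => (u (p.1, p.2 + 1) - 2 * u p + u (p.1, p.2 - 1)) / hy ^ 2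

noncomputable def Dx {Nx Ny : ℕ} (hx : ℝ) (u : ZMod Nx × ZMod Ny → ℝ) : ZMod Nx × ZMod Ny → ℝ :=
  fun p => (u (p.1 + 1, p.2) - u (p.1 - 1, p.2)) / (2 * hx)

noncomputable def Dy {Nx Ny : ℕ} (hy : ℝ) (u : ZMod Nx × ZMod Ny → ℝ) : ZMod Nx × ZMod Ny → ℝ :=
  fun p => (u (p.1, p.2 + 1) - u (p.1, p.2 - 1)) / (2 * hy)

noncomputable def H1x {Nx Ny : ℕ} (ν τ hx : ℝ) (u : ZMod Nx × ZMod Ny → ℝ) : ZMod Nx × ZMod Ny → ℝ :=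
  fun p => Ax u p - (ν * τ / 4) * d2x hx u p

noncomputable def H1y {Nx Ny : ℕ} (ν τ hy : ℝ) (u : ZMod Nx × ZMod Ny → ℝ) : ZMod Nx × ZMod Ny → ℝ :=
  fun p => Ay u p - (ν * τ / 4) * d2y hy u p

lemma shift_sum {Nx Ny : ℕ} [NeZero Nx] [NeZero Ny] (u : ZMod Nx × ZMod Ny → ℝ)
    (c : ZMod Nx × ZMod Ny) : ∑ p, u (p + c) = ∑ p, u p :=
  Equiv.sum_comp (Equiv.addRight c) u

lemma shift_xp {Nx Ny : ℕ} [NeZero Nx] [NeZero Ny] (u : ZMod Nx × ZMod Ny → ℝ) :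
    ∑ p : ZMod Nx × ZMod Ny, u (p.1 + 1, p.2) = ∑ p, u p := by
  rw [← shift_sum u (1, 0)]
  exact Finset.sum_congr rfl fun p _ => congrArg u (by ext <;> simp)

lemma shift_xm {Nx Ny : ℕ} [NeZero Nx] [NeZero Ny] (u : ZMod Nx × ZMod Ny → ℝ) :
    ∑ p : ZMod Nx × ZMod Ny, u (p.1 - 1, p.2) = ∑ p, u p := by
  rw [← shift_sum u (-1, 0)]
  exact Finset.sum_congr rfl fun p _ => congrArg u (by ext <;> simp [sub_eq_add_neg])

lemma shift_yp {Nx Ny : ℕ} [NeZero Nx] [NeZero Ny] (u : ZMod Nx × ZMod Ny → ℝ) :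
    ∑ p : ZMod Nx × ZMod Ny, u (p.1, p.2 + 1) = ∑ p, u p := by
  rw [← shift_sum u (0, 1)]
  exact Finset.sum_congr rfl fun p _ => congrArg u (by ext <;> simp)

lemma shift_ym {Nx Ny : ℕ} [NeZero Nx] [NeZero Ny] (u : ZMod Nx × ZMod Ny → ℝ) :
    ∑ p : ZMod Nx × ZMod Ny, u (p.1, p.2 - 1) = ∑ p, u p := by
  rw [← shift_sum u (0, -1)]
  exact Finset.sum_congr rfl fun p _ => congrArg u (by ext <;> simp [sub_eq_add_neg])

lemma sum_Ax {Nx Ny : ℕ} [NeZero Nx] [NeZero Ny] (u : ZMod Nx × ZMod Ny → ℝ) :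
    ∑ p, Ax u p = ∑ p, u p := by
  simp only [Ax, ← Finset.sum_div, Finset.sum_add_distrib, ← Finset.mul_sum, shift_xm, shift_xp]
  ring

lemma sum_d2x {Nx Ny : ℕ} [NeZero Nx] [NeZero Ny] (h : ℝ) (u : ZMod Nx × ZMod Ny → ℝ) :
    ∑ p, d2x h u p = 0 := by
  simp only [d2x, ← Finset.sum_div, Finset.sum_add_distrib, Finset.sum_sub_distrib,
    ← Finset.mul_sum, shift_xm, shift_xp]
  ring

lemma sum_Ay {Nx Ny : ℕ} [NeZero Nx] [NeZero Ny] (u : ZMod Nx × ZMod Ny → ℝ) :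
    ∑ p, Ay u p = ∑ p, u p := by
  simp only [Ay, ← Finset.sum_div, Finset.sum_add_distrib, ← Finset.mul_sum, shift_ym, shift_yp]
  ring

lemma sum_d2y {Nx Ny : ℕ} [NeZero Nx] [NeZero Ny] (h : ℝ) (u : ZMod Nx × ZMod Ny → ℝ) :
    ∑ p, d2y h u p = 0 := by
  simp only [d2y, ← Finset.sum_div, Finset.sum_add_distrib, Finset.sum_sub_distrib,
    ← Finset.mul_sum, shift_ym, shift_yp]
  ring

theorem adi_diffusion_half_step_mass_conservation
    (Nx Ny : ℕ) [NeZero Nx] [NeZero Ny]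
    (hx hy τ ν : ℝ) (hhx : 0 < hx) (hhy : 0 < hy) (hτ : 0 < τ) (hν : 0 < ν)
    (u0 u1 u2 : ZMod Nx × ZMod Ny → ℝ)
    (hstep1 : ∀ p : ZMod Nx × ZMod Ny,
      H1x ν τ hx (Ay u1) p
        = Ax (Ay u0) p + (ν * τ / 4) * Ay (d2x hx u0) p
          + (ν * τ / 2) * Ax (d2y hy u0) p)
    (hstep2 : ∀ p : ZMod Nx × ZMod Ny,
      H1y ν τ hy u2 p = Ay u1 p - (ν * τ / 4) * d2y hy u0 p) :
    ∑ p : ZMod Nx × ZMod Ny, hx * hy * u2 p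
      = ∑ p : ZMod Nx × ZMod Ny, hx * hy * u0 p := by
  simp only [H1x] at hstep1
  simp only [H1y] at hstep2
  have h1 := Finset.sum_congr (rfl : (Finset.univ : Finset (ZMod Nx × ZMod Ny)) = _)
    fun p _ => hstep1 p
  have h2 := Finset.sum_congr (rfl : (Finset.univ : Finset (ZMod Nx × ZMod Ny)) = _)
    fun p _ => hstep2 p
  simp only [Finset.sum_add_distrib, Finset.sum_sub_distrib, ← Finset.mul_sum,
    sum_Ax, sum_Ay, sum_d2x, sum_d2y, mul_zero, sub_zero, add_zero] at h1 h2
  rw [← Finset.mul_sum, ← Finset.mul_sum, h2, h1]
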